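/- arXiv:2403.04186 — 9 statements merged into one kernel-verified Lean document; each statement's English description precedes it below -/
import Mathlib

section
/- The product ⋄ on 𝔥 = ℚ⟨x,y⟩ is commutative: for all v, w ∈ 𝔥 one has v ⋄ w = w ⋄ v. -/
/-- The generator `x` of `𝔥 = ℚ⟨x,y⟩`. -/
noncomputable def x : FreeAlgebra ℚ (Fin 2) := FreeAlgebra.ι ℚ 0

/-- The generator `y` of `𝔥 = ℚ⟨x,y⟩`. -/
noncomputable def y : FreeAlgebra ℚ (Fin 2) := FreeAlgebra.ι ℚ 1

lemma diamond_aux_induct (P : FreeAlgebra ℚ (Fin 2) → Prop) (h1 : P 1)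
    (hadd : ∀ a b, P a → P b → P (a + b)) (hsmul : ∀ (c : ℚ) a, P a → P (c • a))
    (hx : ∀ a, P a → P (a * x)) (hy : ∀ a, P a → P (a * y)) : ∀ a, P a := by
  have key : ∀ a s, P s → P (s * a) := by
    intro a
    induction a using FreeAlgebra.induction with
    | grade0 r =>
      intro s hs
      rw [← Algebra.commutes, ← Algebra.smul_def]
      exact hsmul r s hs
    | grade1 i =>
      intro s hs
      fin_cases i
      · exact hx s hs
      · exact hy s hs
    | mul a b iha ihb =>
      intro s hs
      rw [← mul_assoc]
      exact ihb _ (iha _ hs)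
    | add a b iha ihb =>
      intro s hs
      rw [mul_add]
      exact hadd _ _ (iha _ hs) (ihb _ hs)
  intro a
  simpa using key a 1 h1

/-- The product `⋄` on `𝔥 = ℚ⟨x,y⟩` is commutative. Here `D` is any `ℚ`-bilinear
map satisfying the defining recursion of `⋄`. -/
theorem diamond_comm
    (D : FreeAlgebra ℚ (Fin 2) →ₗ[ℚ] FreeAlgebra ℚ (Fin 2) →ₗ[ℚ] FreeAlgebra ℚ (Fin 2))
    (hone_right : ∀ w, D w 1 = w)
    (hone_left : ∀ w, D 1 w = w)
    (hxx : ∀ v w, D (v * x) (w * x) = D v (w * x) * x - D (v * y) w * x)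
    (hxy : ∀ v w, D (v * x) (w * y) = D v (w * y) * x + D (v * x) w * y)
    (hyx : ∀ v w, D (v * y) (w * x) = D v (w * x) * y + D (v * y) w * x)
    (hyy : ∀ v w, D (v * y) (w * y) = D v (w * y) * y - D (v * x) w * y) :
    ∀ v w, D v w = D w v := by
  have L : ∀ v w, D (v * x) w + D (v * y) w = D v w * (x + y) := by
    intro v
    refine diamond_aux_induct _ ?_ ?_ ?_ ?_ ?_
    · simp only [hone_right, mul_add]
    · intro a b ha hb
      simp only [map_add, add_mul, ← ha, ← hb]
      abel
    · intro c a ha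
      simp only [map_smul, smul_mul_assoc, ← ha, smul_add]
    · intro a _
      rw [hxx, hyx, mul_add]
      abel
    · intro a _
      rw [hxy, hyy, mul_add]
      abel
  have R : ∀ w v, D v (w * x) + D v (w * y) = D v w * (x + y) := by
    intro w
    refine diamond_aux_induct _ ?_ ?_ ?_ ?_ ?_
    · simp only [hone_left, mul_add]
    · intro a b ha hb
      simp only [map_add, LinearMap.add_apply, add_mul, ← ha, ← hb]
      abel
    · intro c a ha
      simp only [map_smul, LinearMap.smul_apply, smul_mul_assoc, ← ha, smul_add]
    · intro a ha
      have h := congrArg (· * x) (ha.trans (L a w).symm)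
      simp only [add_mul] at h
      rw [hxx, hxy, mul_add, eq_sub_of_add_eq h]
      abel
    · intro a ha
      have h := congrArg (· * y) (ha.trans (L a w).symm)
      simp only [add_mul] at h
      rw [hyx, hyy, mul_add, eq_sub_of_add_eq h]
      abel
  have Z : ∀ v w, D v (w * x) + D v (w * y) = D (v * x) w + D (v * y) w :=
    fun v w => (R w v).trans (L v w).symm
  have X : ∀ v, (∀ w, D v w = D w v) → ∀ w, D (v * x) w = D w (v * x) := by
    intro v hv
    refine diamond_aux_induct _ ?_ ?_ ?_ ?_ ?_
    · rw [hone_left, hone_right]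
    · intro a b ha hb
      simp only [map_add, LinearMap.add_apply, ha, hb]
    · intro c a ha
      simp only [map_smul, LinearMap.smul_apply, ha]
    · intro w hw
      rw [hxx, hxx, ← hw, ← hv (w * y), ← sub_mul, ← sub_mul]
      congr 1
      rw [sub_eq_sub_iff_add_eq_add]
      exact Z v w
    · intro w hw
      rw [hxy, hyx, hw, hv (w * y), add_comm]
  refine diamond_aux_induct _ ?_ ?_ ?_ ?_ ?_
  · intro w
    rw [hone_left, hone_right]
  · intro a b ha hb w
    simp only [map_add, LinearMap.add_apply, ha w, hb w]
  · intro c a ha w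
    simp only [map_smul, LinearMap.smul_apply, ha w]
  · exact X
  · intro v hv w
    have h1 := L v w
    have h2 := R v w
    rw [hv w, ← h2, X v hv w] at h1
    exact add_left_cancel h1
end

section
/- The product ⋄ on 𝔥 = ℚ⟨x,y⟩ is associative: for all u, v, w ∈ 𝔥 one has (u ⋄ v) ⋄ w = u ⋄ (v ⋄ w). -/
/-- Right-end induction on `ℚ⟨x,y⟩` in the generators `x` and `x + y`. -/
theorem right_ind (P : FreeAlgebra ℚ (Fin 2) → Prop)
    (hadd : ∀ a b, P a → P b → P (a + b)) (hsmul : ∀ (r : ℚ) a, P a → P (r • a))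
    (h1 : P 1) (hx : ∀ a, P a → P (a * x)) (hz : ∀ a, P a → P (a * (x + y))) :
    ∀ a, P a := by
  have key : ∀ a v, P v → P (v * a) := by
    intro a
    induction a using FreeAlgebra.induction with
    | grade0 r =>
      intro v hv
      rw [← Algebra.commutes, ← Algebra.smul_def]
      exact hsmul r v hv
    | grade1 i =>
      intro v hv
      fin_cases i
      · exact hx v hv
      · have h : v * y = v * (x + y) + (-1 : ℚ) • (v * x) := by
          rw [mul_add, neg_one_smul]; abel
        change P (v * y)
        rw [h]
        exact hadd _ _ (hz v hv) (hsmul _ _ (hx v hv))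
    | mul a b ha hb =>
      intro v hv
      rw [← mul_assoc]
      exact hb _ (ha v hv)
    | add a b ha hb =>
      intro v hv
      rw [mul_add]
      exact hadd _ _ (ha v hv) (hb v hv)
  intro a
  simpa using key a 1 h1

/-- The product `⋄` on `𝔥 = ℚ⟨x,y⟩` is associative. Here `D` is any `ℚ`-bilinear
map satisfying the defining recursion of `⋄`. -/
theorem diamond_assoc
    (D : FreeAlgebra ℚ (Fin 2) →ₗ[ℚ] FreeAlgebra ℚ (Fin 2) →ₗ[ℚ] FreeAlgebra ℚ (Fin 2))
    (hone_right : ∀ w, D w 1 = w)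
    (hone_left : ∀ w, D 1 w = w)
    (hxx : ∀ v w, D (v * x) (w * x) = D v (w * x) * x - D (v * y) w * x)
    (hxy : ∀ v w, D (v * x) (w * y) = D v (w * y) * x + D (v * x) w * y)
    (hyx : ∀ v w, D (v * y) (w * x) = D v (w * x) * y + D (v * y) w * x)
    (hyy : ∀ v w, D (v * y) (w * y) = D v (w * y) * y - D (v * x) w * y) :
    ∀ u v w, D (D u v) w = D u (D v w) := by
  obtain ⟨z, hz⟩ : ∃ z, z = x + y := ⟨_, rfl⟩
  have hy : y = z - x := by rw [hz]; abel
  have ind := right_ind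
  rw [← hz] at ind
  -- right multiplication by `z = x + y` on the left factor
  have hzl : ∀ v w, D (v * z) w = D v w * z := by
    intro v w
    induction w using ind with
    | hadd a b ha hb => rw [map_add, map_add, ha, hb, add_mul]
    | hsmul r a ha => rw [map_smul, map_smul, ha, smul_mul_assoc]
    | h1 => rw [hone_right, hone_right]
    | hx a _ =>
      rw [hz, mul_add, map_add, LinearMap.add_apply, hxx, hyx, mul_add]; abel
    | hz a _ =>
      simp only [hz, mul_add, map_add, LinearMap.add_apply, hxx, hxy, hyx, hyy, add_mul]; abel
  have hxx' : ∀ v w, D (v * x) (w * x) = (D v (w * x) + D (v * x) w - D v w * z) * x := by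
    intro v w
    rw [hxx, hy, mul_sub, map_sub, LinearMap.sub_apply, hzl]
    simp only [add_mul, sub_mul]; abel
  have hzr : ∀ v w, D v (w * z) = D v w * z := by
    intro v
    induction v using ind with
    | hadd a b ha hb => intro w; simp only [map_add, LinearMap.add_apply, ha, hb, add_mul]
    | hsmul r a ha => intro w; simp only [map_smul, LinearMap.smul_apply, ha, smul_mul_assoc]
    | h1 => intro w; rw [hone_left, hone_left]
    | hz a ha => intro w; rw [hzl, hzl, ha]
    | hx a ha =>
      intro w
      have e1 : D (a * x) (w * z) = D (a * x) (w * x) + D (a * x) (w * y) := by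
        rw [← map_add, ← mul_add, ← hz]
      have e2 : D a (w * y) = D a w * z - D a (w * x) := by
        rw [hy, mul_sub, map_sub, ha]
      rw [e1, hxx', hxy, e2, hy]
      simp only [add_mul, sub_mul, mul_sub]; abel
  intro u
  induction u using ind with
  | hadd a b ha hb => intro v w; simp only [map_add, LinearMap.add_apply, ha, hb]
  | hsmul r a ha => intro v w; simp only [map_smul, LinearMap.smul_apply, ha]
  | h1 => intro v w; rw [hone_left, hone_left]
  | hz a ha => intro v w; rw [hzl, hzl, hzl, ha]
  | hx u hu =>
    intro v
    induction v using ind with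
    | hadd a b ha hb => intro w; simp only [map_add, LinearMap.add_apply, ha, hb]
    | hsmul r a ha => intro w; simp only [map_smul, LinearMap.smul_apply, ha]
    | h1 => intro w; rw [hone_left, hone_right]
    | hz a ha => intro w; rw [hzr, hzl, hzl, hzr, ha]
    | hx v hv =>
      intro w
      induction w using ind with
      | hadd a b ha hb => simp only [map_add, ha, hb]
      | hsmul r a ha => simp only [map_smul, ha]
      | h1 => rw [hone_right, hone_right]
      | hz a ha => rw [hzr, hzr, hzr, ha]
      | hx w hw =>
        have hw' := hw
        have hu' := hu (v * x) (w * x)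
        rw [hxx' v w] at hu'
        rw [hxx' u v] at hw'
        rw [hxx' u v, hxx' v w, hxx', hxx', hw', ← hu']
        simp only [map_add, map_sub, LinearMap.add_apply, LinearMap.sub_apply, hzl, hzr, hu, hv,
          add_mul, sub_mul]
        abel
end

section
/- For all v, w ∈ 𝔥 = ℚ⟨x,y⟩, writing z := x + y, one has vz ⋄ w = (v ⋄ w)z and v ⋄ wz = (v ⋄ w)z. -/
/-- Right-multiplication induction principle for `ℚ⟨x,y⟩`. -/
theorem right_induction (P : FreeAlgebra ℚ (Fin 2) → Prop) (h1 : P 1)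
    (hadd : ∀ a b, P a → P b → P (a + b)) (hsmul : ∀ (c : ℚ) a, P a → P (c • a))
    (hx : ∀ a, P a → P (a * x)) (hy : ∀ a, P a → P (a * y)) (a : FreeAlgebra ℚ (Fin 2)) :
    P a := by
  have key : ∀ v, P v → P (v * a) := by
    induction a using FreeAlgebra.induction with
    | grade0 r =>
      intro v hv
      rw [← Algebra.commutes, ← Algebra.smul_def]
      exact hsmul r v hv
    | grade1 i =>
      intro v hv
      fin_cases i
      · exact hx v hv
      · exact hy v hv
    | mul a b ha hb =>
      intro v hv
      rw [← mul_assoc]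
      exact hb _ (ha v hv)
    | add a b ha hb =>
      intro v hv
      rw [mul_add]
      exact hadd _ _ (ha v hv) (hb v hv)
  simpa using key 1 h1

/-- With `z := x + y`, one has `vz ⋄ w = (v ⋄ w)z` and `v ⋄ wz = (v ⋄ w)z`.
Here `D` is any `ℚ`-bilinear map satisfying the defining recursion of `⋄`. -/
theorem diamond_z_rule
    (D : FreeAlgebra ℚ (Fin 2) →ₗ[ℚ] FreeAlgebra ℚ (Fin 2) →ₗ[ℚ] FreeAlgebra ℚ (Fin 2))
    (hone_right : ∀ w, D w 1 = w)
    (hone_left : ∀ w, D 1 w = w)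
    (hxx : ∀ v w, D (v * x) (w * x) = D v (w * x) * x - D (v * y) w * x)
    (hxy : ∀ v w, D (v * x) (w * y) = D v (w * y) * x + D (v * x) w * y)
    (hyx : ∀ v w, D (v * y) (w * x) = D v (w * x) * y + D (v * y) w * x)
    (hyy : ∀ v w, D (v * y) (w * y) = D v (w * y) * y - D (v * x) w * y) :
    ∀ v w, D (v * (x + y)) w = D v w * (x + y) ∧
      D v (w * (x + y)) = D v w * (x + y) := by
  have hl : ∀ v w, D (v * (x + y)) w = D v w * (x + y) := by
    intro v w
    induction w using right_induction with
    | h1 => rw [hone_right, hone_right]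
    | hadd a b ha hb => rw [map_add, map_add, ha, hb, add_mul]
    | hsmul c a ha => rw [map_smul, map_smul, ha, smul_mul_assoc]
    | hx a _ =>
      rw [mul_add v, map_add, LinearMap.add_apply, hxx, hyx, mul_add]
      abel
    | hy a _ =>
      rw [mul_add v, map_add, LinearMap.add_apply, hxy, hyy, mul_add]
      abel
  intro v w
  refine ⟨hl v w, ?_⟩
  induction v using right_induction with
  | h1 => rw [hone_left, hone_left]
  | hadd a b ha hb =>
    rw [map_add, LinearMap.add_apply, LinearMap.add_apply, ha, hb, add_mul]
  | hsmul c a ha =>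
    rw [map_smul, LinearMap.smul_apply, LinearMap.smul_apply, ha, smul_mul_assoc]
  | hx v ih =>
    have h := hl v w
    rw [← ih, mul_add v, mul_add w, map_add, map_add, LinearMap.add_apply] at h
    have h2 := congrArg (· * x) h
    simp only [add_mul] at h2
    rw [mul_add w, map_add, hxx, hxy, mul_add, eq_sub_of_add_eq h2]
    abel
  | hy v ih =>
    have h := hl v w
    rw [← ih, mul_add v, mul_add w, map_add, map_add, LinearMap.add_apply] at h
    have h2 := congrArg (· * y) h
    simp only [add_mul] at h2
    rw [mul_add w, map_add, hyx, hyy, mul_add, eq_sub_of_add_eq' h2]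
    abel
end

section
/- For all integers k, l ≥ 1 and all v, w ∈ 𝔥 = ℚ⟨x,y⟩, writing z := x + y, one has vz^{k−1}y ⋄ wz^{l−1}y = (v ⋄ wz^{l−1}y)z^{k−1}y + (vz^{k−1}y ⋄ w)z^{l−1}y − (v ⋄ w)z^{k+l−1}y. -/
/-- With `z := x + y`, for `k, l ≥ 1` one has
`vz^{k−1}y ⋄ wz^{l−1}y = (v ⋄ wz^{l−1}y)z^{k−1}y + (vz^{k−1}y ⋄ w)z^{l−1}y − (v ⋄ w)z^{k+l−1}y`.
Here `D` is any `ℚ`-bilinear map satisfying the defining recursion of `⋄`. -/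
theorem diamond_harmonic_rule
    (D : FreeAlgebra ℚ (Fin 2) →ₗ[ℚ] FreeAlgebra ℚ (Fin 2) →ₗ[ℚ] FreeAlgebra ℚ (Fin 2))
    (hone_right : ∀ w, D w 1 = w)
    (hone_left : ∀ w, D 1 w = w)
    (hxx : ∀ v w, D (v * x) (w * x) = D v (w * x) * x - D (v * y) w * x)
    (hxy : ∀ v w, D (v * x) (w * y) = D v (w * y) * x + D (v * x) w * y)
    (hyx : ∀ v w, D (v * y) (w * x) = D v (w * x) * y + D (v * y) w * x)
    (hyy : ∀ v w, D (v * y) (w * y) = D v (w * y) * y - D (v * x) w * y) :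
    ∀ k l : ℕ, 1 ≤ k → 1 ≤ l → ∀ v w,
      D (v * (x + y) ^ (k - 1) * y) (w * (x + y) ^ (l - 1) * y) =
        D v (w * (x + y) ^ (l - 1) * y) * (x + y) ^ (k - 1) * y +
          D (v * (x + y) ^ (k - 1) * y) w * (x + y) ^ (l - 1) * y -
          D v w * (x + y) ^ (k + l - 1) * y := by
  have hL : ∀ w v, D (v * (x + y)) w = D v w * (x + y) := by
    intro w
    induction w using right_induction with
    | h1 => intro v; rw [hone_right, hone_right]
    | hadd a b ha hb => intro v; rw [map_add, map_add, ha, hb, add_mul]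
    | hsmul c a ha => intro v; rw [map_smul, map_smul, ha, smul_mul_assoc]
    | hx a _ =>
      intro v
      rw [mul_add, map_add, LinearMap.add_apply, hxx, hyx, mul_add]
      abel
    | hy a _ =>
      intro v
      rw [mul_add, map_add, LinearMap.add_apply, hxy, hyy, mul_add]
      abel
  have hL' : ∀ w v, D (v * x) w + D (v * y) w = D v w * (x + y) := by
    intro w v
    rw [← hL, mul_add, map_add, LinearMap.add_apply]
  have hR : ∀ v w, D v (w * (x + y)) = D v w * (x + y) := by
    intro v
    induction v using right_induction with
    | h1 => intro w; rw [hone_left, hone_left]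
    | hadd a b ha hb =>
      intro w
      rw [map_add, LinearMap.add_apply, LinearMap.add_apply, ha, hb, add_mul]
    | hsmul c a ha =>
      intro w
      rw [map_smul, LinearMap.smul_apply, LinearMap.smul_apply, ha, smul_mul_assoc]
    | hx a ha =>
      intro w
      have h1 := ha w
      rw [← hL', mul_add, map_add] at h1
      rw [mul_add, map_add, hxx, hxy, eq_sub_of_add_eq h1]
      noncomm_ring
    | hy a ha =>
      intro w
      have h1 := ha w
      rw [← hL', mul_add, map_add] at h1
      rw [mul_add, map_add, hyx, hyy, eq_sub_of_add_eq h1]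
      noncomm_ring
  have hLn : ∀ (n : ℕ) v w, D (v * (x + y) ^ n) w = D v w * (x + y) ^ n := by
    intro n
    induction n with
    | zero => intro v w; simp
    | succ n ih => intro v w; rw [pow_succ, ← mul_assoc, hL, ih, mul_assoc]
  have hRn : ∀ (n : ℕ) v w, D v (w * (x + y) ^ n) = D v w * (x + y) ^ n := by
    intro n
    induction n with
    | zero => intro v w; simp
    | succ n ih => intro v w; rw [pow_succ, ← mul_assoc, hR, ih, mul_assoc]
  intro k l hk hl v w
  obtain ⟨a, rfl⟩ := Nat.exists_eq_add_of_le' hk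
  obtain ⟨b, rfl⟩ := Nat.exists_eq_add_of_le' hl
  have e : a + 1 + (b + 1) - 1 = a + 1 + b := by omega
  rw [e, Nat.add_sub_cancel, Nat.add_sub_cancel, hyy, hLn, hRn,
    eq_sub_of_add_eq (hL' w (v * (x + y) ^ a)), hLn, pow_add _ (a + 1) b, pow_succ]
  simp only [sub_mul, mul_assoc]
  abel
end

section
/- For all w ∈ 𝔥 = ℚ⟨x,y⟩, writing z := x + y, one has y ⋄ wy = wy² − wzy + (y ⋄ w)y. -/
/-- With `z := x + y`, one has `y ⋄ wy = wy² − wzy + (y ⋄ w)y`.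
Here `D` is any `ℚ`-bilinear map satisfying the defining recursion of `⋄`. -/
theorem diamond_y_mul
    (D : FreeAlgebra ℚ (Fin 2) →ₗ[ℚ] FreeAlgebra ℚ (Fin 2) →ₗ[ℚ] FreeAlgebra ℚ (Fin 2))
    (hone_right : ∀ w, D w 1 = w)
    (hone_left : ∀ w, D 1 w = w)
    (hxx : ∀ v w, D (v * x) (w * x) = D v (w * x) * x - D (v * y) w * x)
    (hxy : ∀ v w, D (v * x) (w * y) = D v (w * y) * x + D (v * x) w * y)
    (hyx : ∀ v w, D (v * y) (w * x) = D v (w * x) * y + D (v * y) w * x)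
    (hyy : ∀ v w, D (v * y) (w * y) = D v (w * y) * y - D (v * x) w * y) :
    ∀ w, D y (w * y) = w * y ^ 2 - w * (x + y) * y + D y w * y := by
  have key : ∀ b a : FreeAlgebra ℚ (Fin 2), D x a + D y a = a * (x + y) →
      D x (a * b) + D y (a * b) = (a * b) * (x + y) := by
    intro b
    induction b using FreeAlgebra.induction with
    | grade0 r =>
      intro a ha
      have h : a * algebraMap ℚ (FreeAlgebra ℚ (Fin 2)) r = r • a := by
        rw [Algebra.smul_def, Algebra.commutes]
      rw [h, map_smul, map_smul, ← smul_add, ha, smul_mul_assoc]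
    | grade1 i =>
      intro a _
      fin_cases i
      · change D x (a * x) + D y (a * x) = (a * x) * (x + y)
        have h1 := hxx 1 a
        have h2 := hyx 1 a
        simp only [one_mul, hone_left] at h1 h2
        rw [h1, h2]
        noncomm_ring
      · change D x (a * y) + D y (a * y) = (a * y) * (x + y)
        have h1 := hxy 1 a
        have h2 := hyy 1 a
        simp only [one_mul, hone_left] at h1 h2
        rw [h1, h2]
        noncomm_ring
    | mul b c hb hc =>
      intro a ha
      rw [← mul_assoc]
      exact hc _ (hb a ha)
    | add b c hb hc =>
      intro a ha
      rw [mul_add, map_add, map_add, add_mul, ← hb a ha, ← hc a ha]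
      abel
  intro w
  have hw : D x w + D y w = w * (x + y) := by
    have h := key w 1 (by rw [hone_right, hone_right, one_mul])
    rwa [one_mul] at h
  have h := hyy 1 w
  simp only [one_mul, hone_left] at h
  rw [h, ← hw]
  noncomm_ring
end

section
/- For all w ∈ 𝔥 = ℚ⟨x,y⟩, writing z := x + y, one has y ⋄ w(z+y) − (y ⋄ w)(z+y) = wy² − wzy. -/
theorem decomp_xy (w : FreeAlgebra ℚ (Fin 2)) :
    ∃ (c : ℚ) (a b : FreeAlgebra ℚ (Fin 2)), w = c • 1 + a * x + b * y := by
  induction w using FreeAlgebra.induction with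
  | grade0 r => exact ⟨r, 0, 0, by simp [Algebra.algebraMap_eq_smul_one]⟩
  | grade1 i =>
    fin_cases i
    · exact ⟨0, 1, 0, by simp [x]⟩
    · exact ⟨0, 0, 1, by simp [y]⟩
  | mul u v hu hv =>
    obtain ⟨c, a, b, rfl⟩ := hu
    obtain ⟨c', a', b', rfl⟩ := hv
    refine ⟨c * c', c' • a + (c • 1 + a * x + b * y) * a',
      c' • b + (c • 1 + a * x + b * y) * b', ?_⟩
    simp only [mul_add, add_mul, smul_mul_assoc, mul_smul_comm, one_mul, mul_one, mul_assoc,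
      smul_add, smul_smul, mul_comm c' c]
    abel
  | add u v hu hv =>
    obtain ⟨c, a, b, rfl⟩ := hu
    obtain ⟨c', a', b', rfl⟩ := hv
    refine ⟨c + c', a + a', b + b', ?_⟩
    simp only [add_mul, add_smul]
    abel

/-- With `z := x + y`, one has `y ⋄ w(z+y) − (y ⋄ w)(z+y) = wy² − wzy`.
Here `D` is any `ℚ`-bilinear map satisfying the defining recursion of `⋄`. -/
theorem diamond_y_mul_z_add_y
    (D : FreeAlgebra ℚ (Fin 2) →ₗ[ℚ] FreeAlgebra ℚ (Fin 2) →ₗ[ℚ] FreeAlgebra ℚ (Fin 2))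
    (hone_right : ∀ w, D w 1 = w)
    (hone_left : ∀ w, D 1 w = w)
    (hxx : ∀ v w, D (v * x) (w * x) = D v (w * x) * x - D (v * y) w * x)
    (hxy : ∀ v w, D (v * x) (w * y) = D v (w * y) * x + D (v * x) w * y)
    (hyx : ∀ v w, D (v * y) (w * x) = D v (w * x) * y + D (v * y) w * x)
    (hyy : ∀ v w, D (v * y) (w * y) = D v (w * y) * y - D (v * x) w * y) :
    ∀ w, D y (w * ((x + y) + y)) - D y w * ((x + y) + y) =
      w * y ^ 2 - w * (x + y) * y := by
  have h1 := fun w => hxx 1 w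
  have h2 := fun w => hxy 1 w
  have h3 := fun w => hyx 1 w
  have h4 := fun w => hyy 1 w
  simp only [one_mul, hone_left] at h1 h2 h3 h4
  have key : ∀ w, D x w = w * x + w * y - D y w := by
    intro w
    obtain ⟨c, a, b, rfl⟩ := decomp_xy w
    simp only [map_add, map_smul, hone_right, h1, h2, h3, h4, add_mul, smul_mul_assoc, one_mul]
    abel
  intro w
  simp only [mul_add, map_add, h3, h4, key, add_mul, sub_mul, pow_two, mul_assoc]
  abel
end

section
/- For every integer m ≥ 1, in 𝔥 = ℚ⟨x,y⟩ one has (x+2y)^{m−1}y = Σ over all r ≥ 1 and all compositions (k_1, …, k_r) of m (integers k_i ≥ 1 with k_1 + … + k_r = m) of the word product (x+y)^{k_1−1}y · (x+y)^{k_2−1}y ⋯ (x+y)^{k_r−1}y. -/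
/-- Increment the head of a list of naturals. -/
def incHead : List ℕ → List ℕ
  | [] => []
  | k :: l => (k + 1) :: l

/-- Prepend a block `1` or increment the first block. -/
def compStep (n : ℕ) : Composition (n + 1) ⊕ Composition (n + 1) → Composition (n + 2)
  | Sum.inl c =>
    { blocks := 1 :: c.blocks
      blocks_pos := by
        intro i hi
        rcases List.mem_cons.1 hi with h | h
        · omega
        · exact c.blocks_pos h
      blocks_sum := by simp [c.blocks_sum]; omega }
  | Sum.inr c =>
    { blocks := incHead c.blocks
      blocks_pos := by
        intro i hi
        have hp := fun j (hj : j ∈ c.blocks) => c.blocks_pos hj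
        revert hi hp
        cases c.blocks with
        | nil => simp [incHead]
        | cons k l =>
          intro hi hp
          rcases List.mem_cons.1 hi with h | h
          · omega
          · exact hp i (List.mem_cons_of_mem _ h)
      blocks_sum := by
        have hs := c.blocks_sum
        revert hs
        cases c.blocks with
        | nil => simp
        | cons k l => simp [incHead]; omega }

theorem blocks_cons {n : ℕ} (c : Composition (n + 1)) :
    ∃ k l, c.blocks = (k + 1) :: l := by
  rcases h : c.blocks with _ | ⟨k, l⟩
  · have := c.blocks_sum
    simp [h] at this
  · have : 0 < k := c.blocks_pos (by simp [h])
    exact ⟨k - 1, l, by rw [Nat.sub_add_cancel this]⟩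

theorem compStep_bijective (n : ℕ) : Function.Bijective (compStep n) := by
  rw [Fintype.bijective_iff_injective_and_card]
  constructor
  · rintro (a | a) (b | b) h <;> have h' := congrArg Composition.blocks h <;>
      obtain ⟨k, l, ha⟩ := blocks_cons a <;> obtain ⟨k', l', hb⟩ := blocks_cons b <;>
      simp [compStep, ha, hb, incHead] at h'
    · congr 1; ext1; simp [ha, hb, h']
    · congr 1; ext1; simp [ha, hb, h']
  · simp [composition_card, pow_succ]; ring

theorem x_add_two_y_pow_succ (n : ℕ) :
    (x + 2 * y) ^ n * y =
      ∑ c : Composition (n + 1), (c.blocks.map fun k => (x + y) ^ (k - 1) * y).prod := by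
  induction n with
  | zero =>
    have : Unique (Composition (0 + 1)) :=
      (Fintype.card_eq_one_iff_nonempty_unique.1 (by simp [composition_card])).some
    rw [Fintype.sum_eq_single (Composition.single 1 one_pos)
      (fun c hc => absurd (Subsingleton.elim _ _) hc)]
    simp
  | succ n ih =>
    rw [← (compStep_bijective n).sum_comp, Fintype.sum_sum_type, pow_succ', mul_assoc, ih,
      Finset.mul_sum, ← Finset.sum_add_distrib]
    refine Finset.sum_congr rfl fun c _ => ?_
    obtain ⟨k, l, hc⟩ := blocks_cons c
    simp only [compStep, hc, incHead, List.map_cons, List.prod_cons, Nat.add_sub_cancel, pow_succ',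
      Nat.sub_self, pow_zero, one_mul]
    noncomm_ring

/-- For `m ≥ 1`, `(x+2y)^{m−1}y` equals the sum over all compositions
`(k₁, …, k_r)` of `m` of the word `(x+y)^{k₁−1}y ⋯ (x+y)^{k_r−1}y`. -/
theorem x_add_two_y_pow_eq_sum_compositions :
    ∀ m : ℕ, 1 ≤ m →
      (x + 2 * y) ^ (m - 1) * y =
        ∑ c : Composition m, (c.blocks.map fun k => (x + y) ^ (k - 1) * y).prod := by
  intro m hm
  obtain ⟨n, rfl⟩ := Nat.exists_eq_add_of_le' hm
  exact x_add_two_y_pow_succ n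
end

section
/- For all integers a, b ≥ 1 one has, in 𝔥 = ℚ⟨x,y⟩: R^a(1) ⋄ R^b(1) − R(R^{a−1}(1) ⋄ R^b(1)) − R(R^a(1) ⋄ R^{b−1}(1)) + R²(R^{a−1}(1) ⋄ R^{b−1}(1)) = y ⋄ R(R^{a−1}(1) ⋄ R^{b−1}(1)) − R(y ⋄ (R^{a−1}(1) ⋄ R^{b−1}(1))). (All ⋄-products of elements of 𝔥^1 lie in 𝔥^1, so applying R is legitimate.) -/
/-- For `a, b ≥ 1`:
`Rᵃ(1) ⋄ Rᵇ(1) − R(Rᵃ⁻¹(1) ⋄ Rᵇ(1)) − R(Rᵃ(1) ⋄ Rᵇ⁻¹(1)) + R²(Rᵃ⁻¹(1) ⋄ Rᵇ⁻¹(1))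
  = y ⋄ R(Rᵃ⁻¹(1) ⋄ Rᵇ⁻¹(1)) − R(y ⋄ (Rᵃ⁻¹(1) ⋄ Rᵇ⁻¹(1)))`.
Here `D` is any `ℚ`-bilinear map satisfying the defining recursion of `⋄`, and
`R` is any `ℚ`-linear map satisfying `R(1) = y` and `R(wy) = w(x+2y)y`. -/
theorem diamond_R_coefficient_identity
    (D : FreeAlgebra ℚ (Fin 2) →ₗ[ℚ] FreeAlgebra ℚ (Fin 2) →ₗ[ℚ] FreeAlgebra ℚ (Fin 2))
    (hone_right : ∀ w, D w 1 = w)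
    (hone_left : ∀ w, D 1 w = w)
    (hxx : ∀ v w, D (v * x) (w * x) = D v (w * x) * x - D (v * y) w * x)
    (hxy : ∀ v w, D (v * x) (w * y) = D v (w * y) * x + D (v * x) w * y)
    (hyx : ∀ v w, D (v * y) (w * x) = D v (w * x) * y + D (v * y) w * x)
    (hyy : ∀ v w, D (v * y) (w * y) = D v (w * y) * y - D (v * x) w * y)
    (R : Module.End ℚ (FreeAlgebra ℚ (Fin 2)))
    (hR1 : R 1 = y)
    (hRy : ∀ w : FreeAlgebra ℚ (Fin 2), R (w * y) = w * (x + 2 * y) * y) :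
    ∀ a b : ℕ, 1 ≤ a → 1 ≤ b →
      D ((R ^ a) 1) ((R ^ b) 1)
        - R (D ((R ^ (a - 1)) 1) ((R ^ b) 1))
        - R (D ((R ^ a) 1) ((R ^ (b - 1)) 1))
        + (R ^ 2) (D ((R ^ (a - 1)) 1) ((R ^ (b - 1)) 1)) =
      D y (R (D ((R ^ (a - 1)) 1) ((R ^ (b - 1)) 1)))
        - R (D y (D ((R ^ (a - 1)) 1) ((R ^ (b - 1)) 1))) := by
  obtain ⟨z, hz⟩ : ∃ z, z = x + y := ⟨_, rfl⟩
  have hx : x = z - y := by rw [hz]; abel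
  have ht : x + 2 * y = z + y := by rw [hx]; noncomm_ring
  rw [ht] at hRy
  -- right multiplication by `z = x + y` passes through the product
  have lastl : ∀ w : FreeAlgebra ℚ (Fin 2), ∃ (c : ℚ) (p q : FreeAlgebra ℚ (Fin 2)),
      w = c • 1 + p * x + q * y := by
    intro w
    induction w using FreeAlgebra.induction with
    | grade0 r => exact ⟨r, 0, 0, by simp [Algebra.algebraMap_eq_smul_one]⟩
    | grade1 i =>
      fin_cases i
      · exact ⟨0, 1, 0, by simp [x]⟩
      · exact ⟨0, 0, 1, by simp [y]⟩
    | mul a b ha hb =>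
      obtain ⟨c, p, q, rfl⟩ := ha
      obtain ⟨d, r, s, hb⟩ := hb
      generalize hA : c • 1 + p * x + q * y = A
      refine ⟨d * c, d • p + A * r, d • q + A * s, ?_⟩
      rw [hb, mul_add, mul_add, mul_smul_comm, mul_one]
      nth_rewrite 1 [← hA]
      simp only [smul_add, smul_smul, add_mul, smul_mul_assoc, mul_assoc]
      abel
    | add a b ha hb =>
      obtain ⟨c, p, q, rfl⟩ := ha
      obtain ⟨d, r, s, rfl⟩ := hb
      refine ⟨c + d, p + r, q + s, ?_⟩
      simp only [add_smul, add_mul]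
      abel
  have zl : ∀ v w, D (v * z) w = D v w * z := by
    intro v w
    obtain ⟨c, p, q, rfl⟩ := lastl w
    rw [hz]
    simp only [mul_add, map_add, LinearMap.add_apply, map_smul, hone_right, hxx, hxy, hyx, hyy,
      add_mul, smul_mul_assoc, smul_add]
    abel
  have zr : ∀ v w, D v (w * z) = D v w * z := by
    have step : ∀ v u, (∀ w, D u (w * z) = D u w * z) →
        ∀ w, D (u * v) (w * z) = D (u * v) w * z := by
      intro v
      induction v using FreeAlgebra.induction with
      | grade0 r =>
        intro u hu w
        simp only [Algebra.algebraMap_eq_smul_one, mul_smul_comm, mul_one, map_smul,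
          LinearMap.smul_apply, hu, smul_mul_assoc]
      | grade1 i =>
        intro u hu w
        have e : D (u * x) w + D (u * y) w = D u (w * z) := by
          rw [hu, ← zl, hz, mul_add, map_add, LinearMap.add_apply]
        have e' : D u (w * x) + D u (w * y) = D u (w * z) := by
          rw [hz, mul_add, map_add]
        fin_cases i
        · change D (u * x) (w * z) = D (u * x) w * z
          rw [hz, mul_add, map_add, hxx, hxy, eq_sub_of_add_eq (e'.trans e.symm)]
          noncomm_ring
        · change D (u * y) (w * z) = D (u * y) w * z
          rw [hz, mul_add, map_add, hyx, hyy, eq_sub_of_add_eq (e'.trans e.symm)]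
          noncomm_ring
      | mul a b ha hb =>
        intro u hu w
        rw [← mul_assoc]
        exact hb _ (ha u hu) w
      | add a b ha hb =>
        intro u hu w
        simp only [mul_add, map_add, LinearMap.add_apply, ha u hu, hb u hu, add_mul]
    intro v w
    have := step v 1 (fun w => by rw [hone_left, hone_left]) w
    simpa only [one_mul] using this
  have yy : ∀ v w, D (v * y) (w * y) = (D v (w * y) + D (v * y) w - D v w * z) * y := by
    intro v w
    rw [hyy, hx, mul_sub, map_sub, LinearMap.sub_apply, zl]
    noncomm_ring
  have y1 : ∀ w, D y (w * y) = (w * y + D y w - w * z) * y := by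
    intro w
    have := yy 1 w
    simpa only [one_mul, hone_left] using this
  have y2 : ∀ w, D (w * y) y = (D w y + w * y - w * z) * y := by
    intro w
    have := yy w 1
    simpa only [one_mul, hone_right] using this
  have y3 : D y y = (y + y - z) * y := by
    have := y1 1
    simpa only [one_mul, hone_right] using this
  have zl1 : ∀ w, D z w = w * z := by
    intro w
    have := zl 1 w
    simpa only [one_mul, hone_left] using this
  have zr1 : ∀ w, D w z = w * z := by
    intro w
    have := zr w 1
    simpa only [one_mul, hone_right] using this
  have key : ∀ w, D y (R (w * y)) - R (D y (w * y))
      = w * (z + y) * y * y - 2 * (w * y * z * y) := by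
    intro w
    rw [hRy, y1, y1, hRy, mul_add, map_add, zr, y1]
    noncomm_ring
  have pow : ∀ n, (R ^ (n + 1)) 1 = (z + y) ^ n * y := by
    intro n
    induction n with
    | zero => simp [hR1]
    | succ n ih => rw [pow_succ', Module.End.mul_apply, ih, hRy, pow_succ]
  intro a b ha hb
  obtain ⟨a, rfl⟩ := Nat.exists_eq_add_of_le' ha
  obtain ⟨b, rfl⟩ := Nat.exists_eq_add_of_le' hb
  simp only [Nat.add_sub_cancel, pow_two R, Module.End.mul_apply]
  rcases a with _ | a <;> rcases b with _ | b
  · simp only [zero_add, pow_one, pow_zero, Module.End.one_apply, hone_left, hone_right, hR1]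
    abel
  · simp only [pow]
    simp only [pow_zero, one_mul, Module.End.one_apply, hone_left, hone_right]
    rw [key, pow_succ]
    generalize (z + y) ^ b = β
    simp only [y1, hRy]
    simp only [mul_add, map_add, zr, y1]
    noncomm_ring
  · simp only [pow]
    simp only [pow_zero, one_mul, Module.End.one_apply, hone_left, hone_right]
    rw [key, pow_succ]
    generalize (z + y) ^ a = β
    simp only [y2, hRy]
    simp only [mul_add, map_add, LinearMap.add_apply, zl, y2]
    noncomm_ring
  · rw [pow, pow, pow, pow, yy ((z + y) ^ a) ((z + y) ^ b), key, pow_succ, pow_succ]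
    generalize (z + y) ^ a = α
    generalize (z + y) ^ b = β
    simp only [yy, hRy]
    -- keep the unexpanded products with one factor atomic
    generalize h1 : D α (β * (z + y) * y) = A
    generalize h2 : D (α * (z + y) * y) β = B
    have e1 : D (α * (z + y)) (β * (z + y) * y) = A * z + D (α * y) (β * (z + y) * y) := by
      rw [mul_add α, map_add, LinearMap.add_apply, zl, h1]
    have e2 : D (α * (z + y) * y) (β * (z + y)) = B * z + D (α * (z + y) * y) (β * y) := by
      rw [mul_add β, map_add, zr, h2]
    rw [e1, e2, yy, yy, h1, h2]
    simp only [mul_add, map_add, LinearMap.add_apply, zl, zr, yy]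
    noncomm_ring
end

section
/- For all integers m, n ≥ 1 one has, in 𝔥 = ℚ⟨x,y⟩: R^m(1) ⋄ R^n(1) = Σ_{0 ≤ i ≤ m−1, 0 ≤ j ≤ n−1} R^{m+n−i−j−2}(y ⋄ R(R^i(1) ⋄ R^j(1))) − Σ_{0 ≤ i ≤ m−1, 0 ≤ j ≤ n−1, (i,j) ≠ (0,0)} R^{m+n−i−j−1}(y ⋄ R^i(1) ⋄ R^j(1)). (All ⋄-products of elements of 𝔥^1 lie in 𝔥^1, so the iterates of R are legitimately applied; this identity is the statement σ(f_{m,n}) = 0 expressing a family of relations among rooted tree maps.) -/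
/-- Induction on words, reading the last letter. -/
theorem word_induction (P : FreeAlgebra ℚ (Fin 2) → Prop) (h1 : P 1) (hadd : ∀ a b, P a → P b → P (a + b))
    (hsmul : ∀ (c : ℚ) a, P a → P (c • a)) (hx : ∀ a, P a → P (a * x))
    (hy : ∀ a, P a → P (a * y)) (w : FreeAlgebra ℚ (Fin 2)) : P w := by
  have key : ∀ w : FreeAlgebra ℚ (Fin 2), ∀ a : FreeAlgebra ℚ (Fin 2), P a → P (a * w) := by
    intro w
    induction w using FreeAlgebra.induction with
    | grade0 r =>
      intro a ha
      have : a * algebraMap ℚ (FreeAlgebra ℚ (Fin 2)) r = r • a := by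
        rw [← Algebra.commutes, Algebra.smul_def]
      rw [this]; exact hsmul r a ha
    | grade1 i =>
      intro a ha
      fin_cases i
      · change P (a * x)
        exact hx a ha
      · change P (a * y)
        exact hy a ha
    | mul p q hp hq =>
      intro a ha
      rw [← mul_assoc]; exact hq _ (hp _ ha)
    | add p q hp hq =>
      intro a ha
      rw [mul_add]; exact hadd _ _ (hp _ ha) (hq _ ha)
  simpa using key w 1 h1

/-- Solution of a first order linear recurrence. -/
theorem solve_rec (R : Module.End ℚ (FreeAlgebra ℚ (Fin 2))) (u s : ℕ → FreeAlgebra ℚ (Fin 2)) (h0 : u 0 = 0)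
    (h : ∀ k, u (k + 1) = R (u k) + s k) (n : ℕ) :
    u n = ∑ j ∈ Finset.range n, (R ^ (n - 1 - j)) (s j) := by
  induction n with
  | zero => simpa using h0
  | succ n ih =>
    rw [h, ih, Finset.sum_range_succ, map_sum]
    simp only [Nat.add_sub_cancel, Nat.sub_self, pow_zero, Module.End.one_apply]
    congr 1
    refine Finset.sum_congr rfl fun j hj => ?_
    have hj := Finset.mem_range.1 hj
    rw [show n - j = (n - 1 - j) + 1 by omega, pow_succ']
    rfl

/-- The family of relations of rooted tree maps (`σ(f_{m,n}) = 0`): for `m, n ≥ 1`,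
`Rᵐ(1) ⋄ Rⁿ(1) = Σ_{0≤i≤m−1, 0≤j≤n−1} R^{m+n−i−j−2}(y ⋄ R(Rⁱ(1) ⋄ Rʲ(1)))
  − Σ_{0≤i≤m−1, 0≤j≤n−1, (i,j)≠(0,0)} R^{m+n−i−j−1}(y ⋄ Rⁱ(1) ⋄ Rʲ(1))`.
Here `D` is any `ℚ`-bilinear map satisfying the defining recursion of `⋄`, and
`R` is any `ℚ`-linear map satisfying `R(1) = y` and `R(wy) = w(x+2y)y`. -/
theorem rooted_tree_map_relations
    (D : FreeAlgebra ℚ (Fin 2) →ₗ[ℚ] FreeAlgebra ℚ (Fin 2) →ₗ[ℚ] FreeAlgebra ℚ (Fin 2))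
    (hone_right : ∀ w, D w 1 = w)
    (hone_left : ∀ w, D 1 w = w)
    (hxx : ∀ v w, D (v * x) (w * x) = D v (w * x) * x - D (v * y) w * x)
    (hxy : ∀ v w, D (v * x) (w * y) = D v (w * y) * x + D (v * x) w * y)
    (hyx : ∀ v w, D (v * y) (w * x) = D v (w * x) * y + D (v * y) w * x)
    (hyy : ∀ v w, D (v * y) (w * y) = D v (w * y) * y - D (v * x) w * y)
    (R : Module.End ℚ (FreeAlgebra ℚ (Fin 2)))
    (hR1 : R 1 = y)
    (hRy : ∀ w : FreeAlgebra ℚ (Fin 2), R (w * y) = w * (x + 2 * y) * y) :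
    ∀ m n : ℕ, 1 ≤ m → 1 ≤ n →
      D ((R ^ m) 1) ((R ^ n) 1) =
        (∑ i ∈ Finset.range m, ∑ j ∈ Finset.range n,
          (R ^ (m + n - i - j - 2)) (D y (R (D ((R ^ i) 1) ((R ^ j) 1)))))
        - ∑ p ∈ (Finset.range m ×ˢ Finset.range n).erase (0, 0),
            (R ^ (m + n - p.1 - p.2 - 1)) (D y (D ((R ^ p.1) 1) ((R ^ p.2) 1))) := by
  have hzl : ∀ v w : FreeAlgebra ℚ (Fin 2), D (v * x) w = D v w * (x + y) - D (v * y) w := by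
    intro v w
    induction w using word_induction with
    | h1 => simp only [hone_right]; noncomm_ring
    | hadd a b ha hb => simp only [map_add, ha, hb]; noncomm_ring
    | hsmul c a ha => simp only [map_smul, ha, smul_sub, smul_mul_assoc]
    | hx a _ => rw [hxx, hyx]; noncomm_ring
    | hy a _ => rw [hxy, hyy]; noncomm_ring
  have hzr : ∀ v w : FreeAlgebra ℚ (Fin 2), D v (w * x) = D v w * (x + y) - D v (w * y) := by
    intro v w
    induction v using word_induction with
    | h1 => simp only [hone_left]; noncomm_ring
    | hadd a b ha hb => simp only [map_add, LinearMap.add_apply, ha, hb]; noncomm_ring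
    | hsmul c a ha => simp only [map_smul, LinearMap.smul_apply, ha, smul_sub, smul_mul_assoc]
    | hx a ih => rw [hxx, hxy, hzl a w, ih]; noncomm_ring
    | hy a ih => rw [hyx, hyy, hzl a w, ih]; noncomm_ring
  have hyy2 : ∀ v w : FreeAlgebra ℚ (Fin 2), D (v * y) (w * y)
      = (D v (w * y) + D (v * y) w - D v w * (x + y)) * y := by
    intro v w
    rw [hyy, hzl]; noncomm_ring
  have hyl : ∀ w : FreeAlgebra ℚ (Fin 2), D y (w * y) = (D y w - w * x) * y := by
    intro w
    have := hyy2 1 w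
    simp only [one_mul, hone_left] at this
    rw [this]; noncomm_ring
  have hcomm : ∀ w : FreeAlgebra ℚ (Fin 2), D w y = D y w := by
    intro w
    induction w using word_induction with
    | h1 => rw [hone_left, hone_right]
    | hadd a b ha hb => simp only [map_add, LinearMap.add_apply, ha, hb]
    | hsmul c a ha => simp only [map_smul, LinearMap.smul_apply, ha]
    | hx a ha =>
      have h1 := hxy a 1
      have h2 := hyx 1 a
      simp only [one_mul, hone_left, hone_right] at h1 h2
      rw [h1, h2, ha]; noncomm_ring
    | hy a ha =>
      have h1 := hyy a 1
      simp only [one_mul, hone_right] at h1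
      rw [h1, hyl, ha]; noncomm_ring
  have hR : ∀ w : FreeAlgebra ℚ (Fin 2), R (w * y) = (w * (x + y) + w * y) * y := by
    intro w; rw [hRy]; noncomm_ring
  have hzl2 : ∀ v w : FreeAlgebra ℚ (Fin 2), D (v * (x + y)) w = D v w * (x + y) := by
    intro v w
    rw [mul_add, map_add, LinearMap.add_apply, hzl]; abel
  have hzr2 : ∀ v w : FreeAlgebra ℚ (Fin 2), D v (w * (x + y)) = D v w * (x + y) := by
    intro v w
    rw [mul_add, map_add, hzr]; abel
  have key1 : ∀ e : FreeAlgebra ℚ (Fin 2), D y (R (e * y)) - R (D y (e * y)) = e * (x * y - 2 * y * x) * y := by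
    intro e
    rw [hR, hyl, hyl, hR, map_add, hzr2, hyl]
    noncomm_ring
  have key : ∀ v w : FreeAlgebra ℚ (Fin 2), D (R (v * y)) (R (w * y)) - R (D (v * y) (R (w * y)))
      - R (D (R (v * y)) (w * y)) + R (R (D (v * y) (w * y)))
      = D y (R (D (v * y) (w * y))) - R (D y (D (v * y) (w * y))) := by
    intro v w
    obtain ⟨f, hf⟩ : ∃ f, D v (R (w * y)) = f := ⟨_, rfl⟩
    obtain ⟨g, hg⟩ : ∃ g, D (R (v * y)) w = g := ⟨_, rfl⟩
    obtain ⟨p, hp⟩ : ∃ p, D v w = p := ⟨_, rfl⟩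
    obtain ⟨q, hq⟩ : ∃ q, D v (w * y) = q := ⟨_, rfl⟩
    obtain ⟨r, hr⟩ : ∃ r, D (v * y) w = r := ⟨_, rfl⟩
    have hc : D (v * y) (w * y) = (q + r - p * (x + y)) * y := by
      rw [hyy2, hp, hq, hr]
    obtain ⟨e, he⟩ : ∃ e, q + r - p * (x + y) = e := ⟨_, rfl⟩
    have hrr : r = e + p * (x + y) - q := by rw [← he]; abel
    have hA : D (v * y) (R (w * y))
        = (f + r * (x + y) + e * y - p * (x + y) * (x + y) - q * (x + y)) * y := by
      rw [hR, hyy2, ← hR, hf]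
      simp only [map_add, hzr2, hp, hq, hr, hc, he]
      noncomm_ring
    have hB : D (R (v * y)) (w * y)
        = (g + q * (x + y) + e * y - p * (x + y) * (x + y) - r * (x + y)) * y := by
      rw [hR, hyy2, ← hR, hg]
      simp only [map_add, LinearMap.add_apply, hzl2, hp, hq, hr, hc, he]
      noncomm_ring
    have hAB : D (R (v * y)) (R (w * y)) = (f * (x + y) + D (v * y) (R (w * y))
        + g * (x + y) + D (R (v * y)) (w * y)
        - (p * (x + y) * (x + y) + q * (x + y) + r * (x + y) + e * y) * (x + y)) * y := by
      have h1 : D (R (v * y)) (R (w * y)) = (D (v * (x + y) + v * y) (R (w * y))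
          + D (R (v * y)) (w * (x + y) + w * y)
          - D (v * (x + y) + v * y) (w * (x + y) + w * y) * (x + y)) * y := by
        rw [hR v, hR w, hyy2]
      rw [h1]
      simp only [map_add, LinearMap.add_apply, hzl2, hzr2, hp, hq, hr, hc, he, hf, hg]
      noncomm_ring
    rw [hAB, hA, hB, hc, he, key1, hR, hR, hR, hR, hrr]
    noncomm_ring
  have hend : ∀ m : ℕ, ∃ v, (R ^ (m + 1)) 1 = v * y := by
    intro m
    induction m with
    | zero => exact ⟨1, by simp [hR1]⟩
    | succ m ih =>
      obtain ⟨v, hv⟩ := ih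
      exact ⟨v * (x + y) + v * y, by rw [pow_succ', Module.End.mul_apply, hv, hR]⟩
  have hs : ∀ m : ℕ, (R ^ (m + 1)) 1 = R ((R ^ m) 1) := by
    intro m; rw [pow_succ']; rfl
  let T : ℕ → ℕ → FreeAlgebra ℚ (Fin 2) := fun i j => D y (R (D ((R ^ i) 1) ((R ^ j) 1)))
    - if (i, j) = (0, 0) then 0 else R (D y (D ((R ^ i) 1) ((R ^ j) 1)))
  let Q : ℕ → ℕ → FreeAlgebra ℚ (Fin 2) := fun i j =>
    if i = 0 ∨ j = 0 then 0 else D ((R ^ i) 1) ((R ^ j) 1)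
  have hQ : ∀ i j, Q (i + 1) (j + 1) - R (Q i (j + 1))
      = R (Q (i + 1) j - R (Q i j)) + T i j := by
    intro i j
    rcases i with _ | i <;> rcases j with _ | j
    · simp [Q, T, hR1, hone_left]
    · simp [Q, T, hR1, hone_left, hs (j + 1)]
    · simp [Q, T, hR1, hone_right, hs (i + 1), hcomm]
    · obtain ⟨v, hv⟩ := hend i
      obtain ⟨w, hw⟩ := hend j
      have := key v w
      rw [← hv, ← hw, ← hs, ← hs] at this
      simp only [Q, T, Prod.mk.injEq, Nat.succ_ne_zero, or_self, and_self, if_false, map_sub]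
      rw [← this]; abel
  have hV : ∀ i n, Q (i + 1) n - R (Q i n) = ∑ j ∈ Finset.range n, (R ^ (n - 1 - j)) (T i j) := by
    intro i n
    exact solve_rec R (fun n => Q (i + 1) n - R (Q i n)) (T i) (by simp [Q]) (hQ i) n
  intro m n hm hn
  have hfin : Q m n = ∑ i ∈ Finset.range m,
      (R ^ (m - 1 - i)) (∑ j ∈ Finset.range n, (R ^ (n - 1 - j)) (T i j)) :=
    solve_rec R (fun m => Q m n) (fun i => ∑ j ∈ Finset.range n, (R ^ (n - 1 - j)) (T i j))
      (by simp [Q]) (fun k => by rw [← hV]; abel) m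
  have hQm : Q m n = D ((R ^ m) 1) ((R ^ n) 1) := by
    simp only [Q]; rw [if_neg]; omega
  have hmem : ((0, 0) : ℕ × ℕ) ∈ Finset.range m ×ˢ Finset.range n := by
    simp; omega
  have herase : ∑ p ∈ (Finset.range m ×ˢ Finset.range n).erase (0, 0),
      (R ^ (m + n - p.1 - p.2 - 1)) (D y (D ((R ^ p.1) 1) ((R ^ p.2) 1)))
      = ∑ p ∈ Finset.range m ×ˢ Finset.range n, if p = (0, 0) then 0 else
      (R ^ (m + n - p.1 - p.2 - 1)) (D y (D ((R ^ p.1) 1) ((R ^ p.2) 1))) := by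
    rw [← Finset.add_sum_erase _ _ hmem, if_pos rfl, zero_add]
    refine Finset.sum_congr rfl fun p hp => ?_
    rw [if_neg (Finset.ne_of_mem_erase hp)]
  rw [herase, Finset.sum_product, ← hQm, hfin, ← Finset.sum_sub_distrib]
  refine Finset.sum_congr rfl fun i hi => ?_
  rw [map_sum, ← Finset.sum_sub_distrib]
  refine Finset.sum_congr rfl fun j hj => ?_
  have hi := Finset.mem_range.1 hi
  have hj := Finset.mem_range.1 hj
  rw [← Module.End.mul_apply, ← pow_add,
    show m - 1 - i + (n - 1 - j) = m + n - i - j - 2 by omega]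
  simp only [T, map_sub]
  congr 1
  split_ifs
  · simp
  · rw [show m + n - i - j - 1 = (m + n - i - j - 2) + 1 by omega, pow_succ]
    rfl
end
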